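/- For any rotor-router execution and any time T, the following are equivalent: (i) the state S_T is stable; (ii) S_T admits an ∞-subcycle decomposition; (iii) S_T admits a (2m²)-step subcycle decomposition. -/

import Mathlib

open Finset

namespace RotorRouter

variable {V : Type} [Fintype V] [DecidableEq V] (G : SimpleGraph V) [DecidableRel G.Adj]

/-- The outgoing arcs (darts) of a vertex `v`. -/
def outArcs (v : V) : Finset G.Dart := Finset.univ.filter (fun d => d.fst = v)

/-- The incoming arcs (darts) of a vertex `v`. -/
def inArcs (v : V) : Finset G.Dart := Finset.univ.filter (fun d => d.snd = v)

/-- A state of the rotor-router system: at each vertex, the current pointer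
(represented as an index, in the fixed cyclic order, of an outgoing arc) and the
number of tokens currently located at the vertex. -/
structure State where
  ptr : V → ℕ
  tokens : V → ℕ
  ptr_lt : ∀ v : V, 0 < G.degree v → ptr v < G.degree v

variable (ord : ∀ v : V, Fin (G.degree v) ≃ {d : G.Dart // d.fst = v})

/-- The number of tokens sent out on the `j`-th outgoing arc when `k` tokens leave a
vertex of degree `deg` in round-robin fashion, starting from pointer position `p`. -/
def sentCount (deg p k j : ℕ) : ℕ :=
  ((Finset.range k).filter (fun i => (p + i) % deg = j)).card

/-- The number of tokens sent along the arc `d` during one step from state `S`. -/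
def arcLoad (S : State G) (d : G.Dart) : ℕ :=
  sentCount (G.degree d.fst) (S.ptr d.fst) (S.tokens d.fst)
    (((ord d.fst).symm ⟨d, rfl⟩ : Fin (G.degree d.fst)) : ℕ)

/-- One synchronous step of the rotor-router system: every vertex sends out all of its
tokens in round-robin fashion, advancing its pointer after each token. -/
def step (S : State G) : State G where
  ptr v := if 0 < G.degree v then (S.ptr v + S.tokens v) % G.degree v else S.ptr v
  tokens v := (∑ d ∈ inArcs G v, arcLoad G ord S d) +
    (if 0 < G.degree v then 0 else S.tokens v)
  ptr_lt v h := by simp only [if_pos h]; exact Nat.mod_lt _ h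

/-- `evol S0 t` is the state `S_t` reached after `t` steps from the initial state `S0`. -/
def evol (S0 : State G) (t : ℕ) : State G := (step G ord)^[t] S0

/-- `load S0 t d` is `L_t(d)`, the number of tokens sent along arc `d` during step `t`. -/
def load (S0 : State G) (t : ℕ) (d : G.Dart) : ℕ := arcLoad G ord (evol G ord S0 t) d

/-- `cum S0 t1 t2 d` is the cumulative load `C_{t1}^{t2}(d) = Σ_{t1 ≤ t < t2} L_t(d)`. -/
def cum (S0 : State G) (t1 t2 : ℕ) (d : G.Dart) : ℕ :=
  ∑ t ∈ Finset.Ico t1 t2, load G ord S0 t d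

/-- `cumV S0 t1 t2 v` is the cumulative vertex load `C_{t1}^{t2}(v)`. -/
def cumV (S0 : State G) (t1 t2 : ℕ) (v : V) : ℕ :=
  ∑ t ∈ Finset.Ico t1 t2, (evol G ord S0 t).tokens v

/-- `pot S0 i t` is the `i`-th potential `Φ_i(S_t) = Σ_{e} (C_t^{t+i}(e))²`. -/
def pot (S0 : State G) (i t : ℕ) : ℕ := ∑ d : G.Dart, (cum G ord S0 t (t + i) d) ^ 2

/-- A state `S_t` is stable if it repeats: `S_{t'} = S_t` for some `t' > t`. -/
def IsStable (S0 : State G) (t : ℕ) : Prop :=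
  ∃ t' > t, evol G ord S0 t' = evol G ord S0 t

/-- A family of bijections `in(v) → out(v)` (encoded as a global bijection `M` on darts
with `(M d).fst = d.snd`) is valid w.r.t. the `Δt`-step subcycle decomposition of `S_T`
if `L_t(e) = L_{t+1}(M e)` for all arcs `e` and all `T ≤ t < T + Δt`. -/
def ValidMapping (S0 : State G) (T Δt : ℕ) (M : G.Dart → G.Dart) : Prop :=
  Function.Bijective M ∧ (∀ d : G.Dart, (M d).fst = d.snd) ∧
    ∀ (d : G.Dart) (t : ℕ), T ≤ t → t < T + Δt →
      load G ord S0 t d = load G ord S0 (t + 1) (M d)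

/-- `S_T` admits a `Δt`-step subcycle decomposition. -/
def HasSubcycleDecomp (S0 : State G) (T Δt : ℕ) : Prop :=
  ∃ M : G.Dart → G.Dart, ValidMapping G ord S0 T Δt M


variable {G}

lemma sentCount_eq {deg p j : ℕ} (hp : p < deg) (hj : j < deg) (k : ℕ) :
    sentCount deg p k j = k / deg + if (j + deg - p) % deg < k % deg then 1 else 0 := by
  have hdeg : 0 < deg := by omega
  have key := Nat.count_modEq_card (b := k) hdeg ((j + deg - p) % deg)
  rw [Nat.mod_mod] at key
  rw [← key, Nat.count_eq_card_filter_range, sentCount]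
  congr 1
  refine Finset.filter_congr fun i _ => ?_
  have hshift : p + (j + deg - p) ≡ j [MOD deg] := by
    rw [show p + (j + deg - p) = j + deg by omega]
    simp [Nat.ModEq]
  constructor
  · intro h
    have h1 : p + i ≡ j [MOD deg] := by rw [Nat.ModEq, h, Nat.mod_eq_of_lt hj]
    exact (Nat.ModEq.add_left_cancel' p (h1.trans hshift.symm)).trans (Nat.mod_modEq _ _).symm
  · intro h
    have h1 : p + i ≡ j [MOD deg] :=
      ((h.trans (Nat.mod_modEq _ _)).add_left p).trans hshift
    rwa [Nat.ModEq, Nat.mod_eq_of_lt hj] at h1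

lemma sentCount_add (deg p a b j : ℕ) :
    sentCount deg p (a + b) j = sentCount deg p a j + sentCount deg ((p + a) % deg) b j := by
  simp only [sentCount, Finset.card_filter]
  rw [Finset.sum_range_add]
  simp [Nat.add_assoc]

lemma sum_sentCount {deg : ℕ} (hdeg : 0 < deg) (p k : ℕ) :
    ∑ j : Fin deg, sentCount deg p k j = k := by
  rw [Fin.sum_univ_eq_sum_range (fun j => sentCount deg p k j)]
  have h := Finset.card_eq_sum_card_fiberwise (s := Finset.range k) (t := Finset.range deg)
    (f := fun i => (p + i) % deg) (fun i _ => by simpa using Nat.mod_lt _ hdeg)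
  simpa [sentCount] using h.symm

lemma mem_outArcs {v : V} {d : G.Dart} : d ∈ outArcs G v ↔ d.fst = v := by simp [outArcs]

lemma mem_inArcs {v : V} {d : G.Dart} : d ∈ inArcs G v ↔ d.snd = v := by simp [inArcs]

lemma card_outArcs (v : V) : (outArcs G v).card = G.degree v := by
  simpa [outArcs] using G.dart_fst_fiber_card_eq_degree v

lemma card_inArcs (v : V) : (inArcs G v).card = G.degree v := by
  rw [← card_outArcs]
  refine Finset.card_bij' (fun d _ => d.symm) (fun d _ => d.symm) ?_ ?_ ?_ ?_ <;>
    simp [mem_inArcs, mem_outArcs]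

lemma degree_fst_pos (d : G.Dart) : 0 < G.degree d.fst := by
  rw [← card_outArcs]
  exact Finset.card_pos.mpr ⟨d, mem_outArcs.mpr rfl⟩

lemma inArcs_eq_empty {v : V} (hv : ¬ 0 < G.degree v) : inArcs G v = ∅ := by
  rw [← Finset.card_eq_zero, card_inArcs]; omega

/-- The position of an outgoing arc in the fixed cyclic order at its tail. -/
def arcIndex (d : G.Dart) : ℕ := (((ord d.fst).symm ⟨d, rfl⟩ : Fin (G.degree d.fst)) : ℕ)

/-- The number of tokens that leave the tail of `d`, starting from state `S`, before the
first token that is sent along `d`. -/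
def rotorRank (S : State G) (d : G.Dart) : ℕ :=
  (arcIndex ord d + G.degree d.fst - S.ptr d.fst) % G.degree d.fst

lemma sum_outArcs_arcLoad (S : State G) {v : V} (hv : 0 < G.degree v) :
    ∑ d ∈ outArcs G v, arcLoad G ord S d = S.tokens v := by
  have h := sum_sentCount hv (S.ptr v) (S.tokens v)
  rw [← Equiv.sum_comp (ord v).symm] at h
  rw [← h]
  have h2 : ∑ d ∈ outArcs G v, arcLoad G ord S d =
      ∑ d : {d : G.Dart // d.fst = v}, arcLoad G ord S d :=
    Finset.sum_subtype _ (fun d => mem_outArcs) _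
  rw [h2]
  refine Finset.sum_congr rfl ?_
  rintro ⟨d, rfl⟩ _
  rfl

variable (S0 : State G)

lemma evol_succ (t : ℕ) : evol G ord S0 (t + 1) = step G ord (evol G ord S0 t) := by
  simp [evol, Function.iterate_succ_apply']

lemma sum_outArcs_load (t : ℕ) {v : V} (hv : 0 < G.degree v) :
    ∑ d ∈ outArcs G v, load G ord S0 t d = (evol G ord S0 t).tokens v :=
  sum_outArcs_arcLoad ord _ hv

lemma sum_inArcs_load (t : ℕ) {v : V} (hv : 0 < G.degree v) :
    ∑ d ∈ inArcs G v, load G ord S0 t d = (evol G ord S0 (t + 1)).tokens v := by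
  simp [evol_succ, step, hv, load]

lemma cum_succ (t i : ℕ) (d : G.Dart) :
    cum G ord S0 t (t + (i + 1)) d = cum G ord S0 t (t + i) d + load G ord S0 (t + i) d := by
  rw [cum, ← Nat.add_assoc, Finset.sum_Ico_succ_top (by omega), cum]

lemma cumV_succ (t i : ℕ) (v : V) :
    cumV G ord S0 t (t + (i + 1)) v =
      cumV G ord S0 t (t + i) v + (evol G ord S0 (t + i)).tokens v := by
  rw [cumV, ← Nat.add_assoc, Finset.sum_Ico_succ_top (by omega), cumV]

lemma sum_outArcs_cum (t i : ℕ) {v : V} (hv : 0 < G.degree v) :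
    ∑ d ∈ outArcs G v, cum G ord S0 t (t + i) d = cumV G ord S0 t (t + i) v := by
  induction i with
  | zero => simp [cum, cumV]
  | succ i ih =>
    simp only [cum_succ, cumV_succ, Finset.sum_add_distrib, ih, sum_outArcs_load ord S0 _ hv]

lemma sum_inArcs_cum (t i : ℕ) {v : V} (hv : 0 < G.degree v) :
    ∑ d ∈ inArcs G v, cum G ord S0 t (t + i) d = cumV G ord S0 (t + 1) (t + 1 + i) v := by
  induction i with
  | zero => simp [cum, cumV]
  | succ i ih =>
    rw [cumV_succ]
    simp only [cum_succ, Finset.sum_add_distrib, ih, sum_inArcs_load ord S0 _ hv]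
    rw [show t + i + 1 = t + 1 + i by omega]

lemma ptr_evol_add (t i : ℕ) {v : V} (hv : 0 < G.degree v) :
    (evol G ord S0 (t + i)).ptr v =
      ((evol G ord S0 t).ptr v + cumV G ord S0 t (t + i) v) % G.degree v := by
  induction i with
  | zero => simpa [cumV] using (Nat.mod_eq_of_lt ((evol G ord S0 t).ptr_lt v hv)).symm
  | succ i ih =>
    rw [cumV_succ, ← Nat.add_assoc, evol_succ]
    simp only [step, hv, if_true, ih]
    rw [Nat.mod_add_mod, Nat.add_assoc]

lemma cum_eq_sentCount (t i : ℕ) (d : G.Dart) :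
    cum G ord S0 t (t + i) d = sentCount (G.degree d.fst) ((evol G ord S0 t).ptr d.fst)
      (cumV G ord S0 t (t + i) d.fst) (arcIndex ord d) := by
  induction i with
  | zero => simp [cum, cumV, sentCount]
  | succ i ih =>
    rw [cum_succ, cumV_succ, sentCount_add, ih, ← ptr_evol_add ord S0 t i (degree_fst_pos d)]
    rfl

lemma cum_eq (t i : ℕ) (d : G.Dart) :
    cum G ord S0 t (t + i) d = cumV G ord S0 t (t + i) d.fst / G.degree d.fst +
      if rotorRank ord (evol G ord S0 t) d < cumV G ord S0 t (t + i) d.fst % G.degree d.fst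
      then 1 else 0 := by
  rw [cum_eq_sentCount, sentCount_eq ((evol G ord S0 t).ptr_lt _ (degree_fst_pos d))
    (j := arcIndex ord d) (Fin.isLt _)]
  rfl

/-- Two quantities are aligned when the first is the larger one and they differ by at most
one. -/
def Aligned (a b : ℕ) : Prop := b ≤ a ∧ a ≤ b + 1

lemma aligned_cum (t i : ℕ) {d d' : G.Dart} (h : d.fst = d'.fst)
    (hr : rotorRank ord (evol G ord S0 t) d ≤ rotorRank ord (evol G ord S0 t) d') :
    Aligned (cum G ord S0 t (t + i) d) (cum G ord S0 t (t + i) d') := by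
  rw [cum_eq, cum_eq, ← h]
  unfold Aligned
  split_ifs <;> omega

lemma eqOn_of_aligned {α : Type*} {s : Finset α} {f g : α → ℕ}
    (h : ∀ a ∈ s, ∀ b ∈ s, (Aligned (f a) (f b) ∧ Aligned (g a) (g b)) ∨
      (Aligned (f b) (f a) ∧ Aligned (g b) (g a)))
    (hsum : ∑ a ∈ s, f a = ∑ a ∈ s, g a) : ∀ a ∈ s, f a = g a := by
  by_contra! hne
  obtain ⟨a, ha, hne⟩ := hne
  rcases Nat.lt_or_gt_of_ne hne with hlt | hlt
  · obtain ⟨b, hb, hlt'⟩ : ∃ b ∈ s, g b < f b := by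
      by_contra! hle
      exact (Finset.sum_lt_sum hle ⟨a, ha, hlt⟩).ne hsum
    have := h a ha b hb
    unfold Aligned at this
    omega
  · obtain ⟨b, hb, hlt'⟩ : ∃ b ∈ s, f b < g b := by
      by_contra! hle
      exact (Finset.sum_lt_sum hle ⟨a, ha, hlt⟩).ne' hsum
    have := h a ha b hb
    unfold Aligned at this
    omega

lemma exists_common_period {α : Type*} [Fintype α] {f : α → α} (hf : Function.Injective f)
    {m : ℕ} (hcard : Fintype.card α = 2 * m) (hm : 2 ≤ m) (x y : α) :
    ∃ l, 0 < l ∧ l ≤ m ^ 2 ∧ Function.IsPeriodicPt f l x ∧ Function.IsPeriodicPt f l y := by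
  classical
  have hper (z : α) : z ∈ Function.periodicPts f := hf.mem_periodicPts z
  have hpos (z : α) := Function.minimalPeriod_pos_of_mem_periodicPts (hper z)
  set p := Function.minimalPeriod f with hp
  let orbit (z : α) : Finset α := (Finset.range (p z)).image fun i => f^[i] z
  have horbit (z : α) : (orbit z).card = p z := by
    rw [Finset.card_image_of_injOn, Finset.card_range]
    intro i hi j hj hij
    exact Function.iterate_injOn_Iio_minimalPeriod (by simpa using hi) (by simpa using hj) hij
  by_cases hdisj : Disjoint (orbit x) (orbit y)
  · have hle : p x + p y ≤ 2 * m := by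
      rw [← horbit, ← horbit, ← Finset.card_union_of_disjoint hdisj, ← hcard]
      exact Finset.card_le_univ _
    refine ⟨p x * p y, Nat.mul_pos (hpos x) (hpos y), ?_,
      (Function.isPeriodicPt_minimalPeriod f x).mul_const _,
      (Function.isPeriodicPt_minimalPeriod f y).const_mul _⟩
    have h4 : 4 * (p x * p y) ≤ 4 * m ^ 2 := by
      have h1 := four_mul_le_sq_add (p x) (p y)
      have h2 := Nat.pow_le_pow_left hle 2
      nlinarith
    omega
  · obtain ⟨z, hzx, hzy⟩ := Finset.not_disjoint_iff.mp hdisj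
    obtain ⟨i, -, hi⟩ := Finset.mem_image.mp hzx
    obtain ⟨j, -, hj⟩ := Finset.mem_image.mp hzy
    have hxy : p x = p y := by
      rw [hp, ← Function.minimalPeriod_apply_iterate (hper x) i,
        ← Function.minimalPeriod_apply_iterate (hper y) j]
      exact congrArg _ (hi.trans hj.symm)
    refine ⟨p x, hpos x, ?_, Function.isPeriodicPt_minimalPeriod f x,
      hxy ▸ Function.isPeriodicPt_minimalPeriod f y⟩
    have hle : p x ≤ 2 * m := by
      rw [← horbit, ← hcard]
      exact Finset.card_le_univ _
    nlinarith

lemma two_le_card_edgeFinset {d d' : G.Dart} (hne : d ≠ d') (h : d.fst = d'.fst) :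
    2 ≤ G.edgeFinset.card := by
  have hfst (e : G.Dart) : e.fst ≠ e.snd := e.adj.ne
  have h1 : d.symm ≠ d := d.symm_ne
  have h2 : d.symm ≠ d' := fun he => hfst d (by rw [h, ← he]; rfl)
  have h3 : ({d, d', d.symm} : Finset G.Dart).card ≤ Fintype.card G.Dart :=
    Finset.card_le_univ _
  rw [Finset.card_eq_three.mpr ⟨d, d', d.symm, hne, h1.symm, h2.symm, rfl⟩,
    G.dart_card_eq_twice_card_edges] at h3
  omega

lemma sum_range_comp_iterate_add {α : Type*} {f : α → α} {x : α} {l : ℕ}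
    (hx : Function.IsPeriodicPt f l x) (w : α → ℕ) (i : ℕ) :
    ∑ k ∈ Finset.range (l + i), w (f^[k] x) =
      ∑ k ∈ Finset.range l, w (f^[k] x) + ∑ k ∈ Finset.range i, w (f^[k] x) := by
  rw [Finset.sum_range_add]
  congr 1
  refine Finset.sum_congr rfl fun k _ => ?_
  rw [Nat.add_comm, Function.iterate_add_apply, hx.eq]

/-- If the partial sums of `w` along two periodic orbits with common period `l` are aligned for
two periods, then they are always aligned. -/
lemma aligned_sum_of_periodic {α : Type*} {f : α → α} {x y : α} {l : ℕ} (hl : 0 < l)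
    (hx : Function.IsPeriodicPt f l x) (hy : Function.IsPeriodicPt f l y) (w : α → ℕ)
    (h : ∀ i ≤ 2 * l, Aligned (∑ k ∈ Finset.range i, w (f^[k] x))
      (∑ k ∈ Finset.range i, w (f^[k] y))) (i : ℕ) :
    Aligned (∑ k ∈ Finset.range i, w (f^[k] x)) (∑ k ∈ Finset.range i, w (f^[k] y)) := by
  have heq : ∑ k ∈ Finset.range l, w (f^[k] x) = ∑ k ∈ Finset.range l, w (f^[k] y) := by
    have h1 := h l (by omega)
    have h2 := h (l + l) (by omega)
    rw [sum_range_comp_iterate_add hx, sum_range_comp_iterate_add hy] at h2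
    unfold Aligned at h1 h2
    omega
  induction i using Nat.strong_induction_on with
  | _ i ih =>
    rcases Nat.lt_or_ge i l with hi | hi
    · exact h i (by omega)
    · obtain ⟨j, rfl⟩ := Nat.exists_eq_add_of_le hi
      have := ih j (by omega)
      rw [sum_range_comp_iterate_add hx, sum_range_comp_iterate_add hy, heq]
      unfold Aligned at this ⊢
      omega

lemma cum_eq_sum_range (T i : ℕ) (d : G.Dart) :
    cum G ord S0 T (T + i) d = ∑ k ∈ Finset.range i, load G ord S0 (T + k) d := by
  simp [cum, Finset.sum_Ico_eq_sum_range]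

lemma sum_outArcs_eq_sum_inArcs {σ : Equiv.Perm G.Dart} (hσ : ∀ d, (σ d).fst = d.snd)
    (w : G.Dart → ℕ) (v : V) : ∑ d ∈ outArcs G v, w d = ∑ d ∈ inArcs G v, w (σ d) := by
  refine Finset.sum_bij' (fun d _ => σ.symm d) (fun d _ => σ d) ?_ ?_ ?_ ?_ ?_
  · intro d hd
    rw [mem_outArcs] at hd
    rw [mem_inArcs, ← hσ, Equiv.apply_symm_apply, hd]
  · intro d hd
    rw [mem_inArcs] at hd
    rw [mem_outArcs, hσ, hd]
  all_goals simp

/-- A subcycle decomposition that is valid for `2 * m ^ 2` steps is valid forever. -/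
lemma load_add_eq {σ : Equiv.Perm G.Dart} {T : ℕ}
    (hσ : ValidMapping G ord S0 T (2 * G.edgeFinset.card ^ 2) σ) (i : ℕ) (d : G.Dart) :
    load G ord S0 (T + i) d = load G ord S0 T (σ.symm^[i] d) := by
  obtain ⟨-, hfst, hload⟩ := hσ
  have hbase : ∀ i ≤ 2 * G.edgeFinset.card ^ 2, ∀ d,
      load G ord S0 (T + i) d = load G ord S0 T (σ.symm^[i] d) := by
    intro i
    induction i with
    | zero => simp
    | succ i ih =>
      intro hi d
      rw [Function.iterate_succ_apply, ← ih (by omega), hload _ (T + i) (by omega) (by omega),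
        Equiv.apply_symm_apply, Nat.add_assoc]
  have haligned (d d' : G.Dart) (h : d.fst = d'.fst)
      (hr : rotorRank ord (evol G ord S0 T) d ≤ rotorRank ord (evol G ord S0 T) d') (i : ℕ) :
      Aligned (∑ k ∈ Finset.range i, load G ord S0 T (σ.symm^[k] d))
        (∑ k ∈ Finset.range i, load G ord S0 T (σ.symm^[k] d')) := by
    rcases eq_or_ne d d' with rfl | hne
    · simp [Aligned]
    obtain ⟨l, hl, hle, hx, hy⟩ := exists_common_period σ.symm.injective
      G.dart_card_eq_twice_card_edges (two_le_card_edgeFinset hne h) d d'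
    refine aligned_sum_of_periodic hl hx hy _ (fun i hi => ?_) i
    have hcum (e : G.Dart) : ∑ k ∈ Finset.range i, load G ord S0 T (σ.symm^[k] e) =
        cum G ord S0 T (T + i) e := by
      rw [cum_eq_sum_range]
      refine Finset.sum_congr rfl fun k hk => (hbase k ?_ e).symm
      have := Finset.mem_range.mp hk
      omega
    rw [hcum, hcum]
    exact aligned_cum ord S0 T i h hr
  induction i using Nat.strong_induction_on generalizing d with
  | _ i ih =>
    rcases i with _ | i
    · rfl
    have hcum (j : ℕ) (hj : j ≤ i + 1) (e : G.Dart) : cum G ord S0 T (T + j) e =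
        ∑ k ∈ Finset.range j, load G ord S0 T (σ.symm^[k] e) := by
      rw [cum_eq_sum_range]
      refine Finset.sum_congr rfl fun k hk => ih k ?_ e
      have := Finset.mem_range.mp hk
      omega
    have hv := degree_fst_pos d
    have hsum : ∑ e ∈ outArcs G d.fst, load G ord S0 (T + (i + 1)) e =
        ∑ e ∈ outArcs G d.fst, load G ord S0 T (σ.symm^[i + 1] e) := by
      rw [sum_outArcs_load ord S0 _ hv, ← Nat.add_assoc, ← sum_inArcs_load ord S0 _ hv,
        sum_outArcs_eq_sum_inArcs hfst]
      refine Finset.sum_congr rfl fun e _ => ?_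
      rw [ih i (by omega), Function.iterate_succ_apply, Equiv.symm_apply_apply]
    have key := eqOn_of_aligned (s := outArcs G d.fst)
      (f := fun e => cum G ord S0 T (T + (i + 2)) e)
      (g := fun e => ∑ k ∈ Finset.range (i + 2), load G ord S0 T (σ.symm^[k] e))
      (fun a ha b hb => by
        rw [mem_outArcs] at ha hb
        rcases le_total (rotorRank ord (evol G ord S0 T) a)
          (rotorRank ord (evol G ord S0 T) b) with hr | hr
        · exact Or.inl ⟨aligned_cum ord S0 T _ (ha.trans hb.symm) hr,
            haligned _ _ (ha.trans hb.symm) hr _⟩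
        · exact Or.inr ⟨aligned_cum ord S0 T _ (hb.trans ha.symm) hr,
            haligned _ _ (hb.trans ha.symm) hr _⟩)
      (by
        simp only [cum_succ ord S0 T (i + 1), Finset.sum_range_succ _ (i + 1),
          Finset.sum_add_distrib, hsum, hcum (i + 1) le_rfl])
      d (mem_outArcs.mpr rfl)
    simpa only [cum_succ ord S0 T (i + 1), Finset.sum_range_succ _ (i + 1),
      hcum (i + 1) le_rfl, Nat.add_left_cancel_iff] using key

lemma evol_of_degree_eq_zero {v : V} (hv : ¬ 0 < G.degree v) (t : ℕ) :
    (evol G ord S0 t).ptr v = S0.ptr v ∧ (evol G ord S0 t).tokens v = S0.tokens v := by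
  induction t with
  | zero => simp [evol]
  | succ t ih => simpa only [evol_succ, step, hv, if_false, inArcs_eq_empty hv,
      Finset.sum_empty, Nat.zero_add] using ih

/-- A state is stable as soon as the loads are periodic from it on. -/
lemma isStable_of_load_periodic {T K : ℕ} (hK : 0 < K)
    (h : ∀ i d, load G ord S0 (T + (i + K)) d = load G ord S0 (T + i) d) :
    IsStable G ord S0 T := by
  have hext {S S' : State G} (hp : S.ptr = S'.ptr) (ht : S.tokens = S'.tokens) : S = S' := by
    cases S; cases S'; simp_all
  let D := (Fintype.card V).factorial
  have htok (i : ℕ) {v : V} (hv : 0 < G.degree v) :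
      (evol G ord S0 (T + (i + K))).tokens v = (evol G ord S0 (T + i)).tokens v := by
    rw [← sum_outArcs_load ord S0 _ hv, ← sum_outArcs_load ord S0 _ hv]
    exact Finset.sum_congr rfl fun d _ => h i d
  have htok_mul (n i : ℕ) {v : V} (hv : 0 < G.degree v) :
      (evol G ord S0 (T + (i + K * n))).tokens v = (evol G ord S0 (T + i)).tokens v := by
    induction n with
    | zero => simp
    | succ n ih => rw [Nat.mul_succ, ← Nat.add_assoc i, htok _ hv, ih]
  have hcum (n : ℕ) {v : V} (hv : 0 < G.degree v) :
      cumV G ord S0 T (T + K * n) v = n * cumV G ord S0 T (T + K) v := by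
    simp only [cumV, Finset.sum_Ico_eq_sum_range, Nat.add_sub_cancel_left]
    induction n with
    | zero => simp
    | succ n ih =>
      rw [Nat.mul_succ, Finset.sum_range_add, ih, Nat.succ_mul]
      congr 1
      refine Finset.sum_congr rfl fun k _ => ?_
      rw [Nat.add_comm (K * n), htok_mul _ _ hv]
  refine ⟨T + K * D, Nat.lt_add_of_pos_right (Nat.mul_pos hK (Nat.factorial_pos _)),
    hext ?_ ?_⟩ <;> ext v <;> by_cases hv : 0 < G.degree v
  · obtain ⟨c, hc⟩ : G.degree v ∣ D := Nat.dvd_factorial hv (G.degree_lt_card_verts v).le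
    rw [ptr_evol_add ord S0 _ _ hv, hcum _ hv, hc, Nat.mul_assoc, Nat.add_mul_mod_self_left]
    exact Nat.mod_eq_of_lt ((evol G ord S0 T).ptr_lt v hv)
  · simp only [evol_of_degree_eq_zero ord S0 hv]
  · simpa using htok_mul D 0 hv
  · simp only [evol_of_degree_eq_zero ord S0 hv]

lemma isStable_of_hasSubcycleDecomp {T : ℕ}
    (h : HasSubcycleDecomp G ord S0 T (2 * G.edgeFinset.card ^ 2)) : IsStable G ord S0 T := by
  obtain ⟨M, hM⟩ := h
  obtain ⟨σ, rfl⟩ : ∃ σ : Equiv.Perm G.Dart, ⇑σ = M :=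
    ⟨Equiv.ofBijective M hM.1, rfl⟩
  refine isStable_of_load_periodic ord S0 (orderOf_pos σ.symm) fun i d => ?_
  rw [load_add_eq ord S0 hM, load_add_eq ord S0 hM, Function.iterate_add_apply,
    Equiv.Perm.iterate_eq_pow σ.symm (orderOf _), pow_orderOf_eq_one, Equiv.Perm.one_apply]

/-- A nonnegative quantity that vanishes exactly when `x` is `q` or `q + 1`. -/
def excess (q x : ℕ) : ℤ := ((x : ℤ) - q) * ((x : ℤ) - q - 1)

lemma excess_nonneg (q x : ℕ) : 0 ≤ excess q x := by
  unfold excess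
  rcases le_or_gt x q with h | h
  · exact mul_nonneg_of_nonpos_of_nonpos (by omega) (by omega)
  · exact mul_nonneg (by omega) (by omega)

lemma excess_eq_zero_iff {q x : ℕ} : excess q x = 0 ↔ x = q ∨ x = q + 1 := by
  unfold excess
  rw [mul_eq_zero]
  omega

lemma sum_sq_eq {α : Type*} (s : Finset α) (f : α → ℕ) (q : ℕ) :
    ∑ a ∈ s, (f a : ℤ) ^ 2 = ∑ a ∈ s, excess q (f a) + (2 * q + 1) * (∑ a ∈ s, f a : ℕ) -
      s.card * (q * (q + 1)) := by
  push_cast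
  rw [Finset.mul_sum, ← Finset.sum_add_distrib, ← nsmul_eq_mul, ← Finset.sum_const,
    ← Finset.sum_sub_distrib]
  refine Finset.sum_congr rfl fun a _ => ?_
  unfold excess
  ring

/-- The share every arc out of `v` is guaranteed in the window of length `i` after `t`. -/
def quota (i t : ℕ) (v : V) : ℕ := cumV G ord S0 t (t + i) v / G.degree v

/-- The potential drops by the excess of the loads of the incoming arcs. -/
lemma pot_eq_add_sum_excess (i t : ℕ) :
    (pot G ord S0 i t : ℤ) = pot G ord S0 i (t + 1) +
      ∑ d : G.Dart, excess (quota ord S0 i (t + 1) d.snd) (cum G ord S0 t (t + i) d) := by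
  unfold pot
  push_cast
  rw [← Finset.sum_fiberwise Finset.univ (fun d : G.Dart => d.snd)
      (fun d => (cum G ord S0 t (t + i) d : ℤ) ^ 2),
    ← Finset.sum_fiberwise Finset.univ (fun d : G.Dart => d.fst),
    ← Finset.sum_fiberwise Finset.univ (fun d : G.Dart => d.snd) (fun d => excess _ _),
    ← Finset.sum_add_distrib]
  refine Finset.sum_congr rfl fun v _ => ?_
  change ∑ d ∈ inArcs G v, _ = ∑ d ∈ outArcs G v, _ + ∑ d ∈ inArcs G v, _
  by_cases hv : 0 < G.degree v
  · have hin : ∑ d ∈ inArcs G v,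
        excess (quota ord S0 i (t + 1) d.snd) (cum G ord S0 t (t + i) d) =
        ∑ d ∈ inArcs G v, excess (quota ord S0 i (t + 1) v) (cum G ord S0 t (t + i) d) :=
      Finset.sum_congr rfl fun d hd => by rw [mem_inArcs.mp hd]
    have hout : ∑ d ∈ outArcs G v, excess (quota ord S0 i (t + 1) v)
        (cum G ord S0 (t + 1) (t + 1 + i) d) = 0 := by
      refine Finset.sum_eq_zero fun d hd => excess_eq_zero_iff.mpr ?_
      rw [cum_eq, mem_outArcs.mp hd, quota]
      split_ifs <;> omega
    rw [hin, sum_sq_eq _ _ (quota ord S0 i (t + 1) v), sum_sq_eq (outArcs G v) _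
      (quota ord S0 i (t + 1) v), hout, sum_inArcs_cum ord S0 _ _ hv,
      sum_outArcs_cum ord S0 _ _ hv, card_inArcs, card_outArcs]
    ring
  · have hout : outArcs G v = ∅ := by rw [← Finset.card_eq_zero, card_outArcs]; omega
    simp [inArcs_eq_empty hv, hout]

lemma pot_antitone (i : ℕ) : Antitone (pot G ord S0 i) := by
  refine antitone_nat_of_succ_le fun t => ?_
  have h := pot_eq_add_sum_excess ord S0 i t
  have := Finset.sum_nonneg fun (d : G.Dart) (_ : d ∈ Finset.univ) =>
    excess_nonneg (quota ord S0 i (t + 1) d.snd) (cum G ord S0 t (t + i) d)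
  omega

variable {S0} in
lemma pot_succ_eq_of_isStable {T : ℕ} (h : IsStable G ord S0 T) (i k : ℕ) :
    pot G ord S0 i (T + k + 1) = pot G ord S0 i (T + k) := by
  obtain ⟨T', hT, heq⟩ := h
  have hev (j : ℕ) : evol G ord S0 (T' + j) = evol G ord S0 (T + j) := by
    induction j with
    | zero => exact heq
    | succ j ih => rw [← Nat.add_assoc, evol_succ, ih, ← evol_succ, Nat.add_assoc]
  have hpot : pot G ord S0 i (T' + k) = pot G ord S0 i (T + k) := by
    simp only [pot, cum_eq_sum_range, load]
    simp only [Nat.add_assoc, hev]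
  refine le_antisymm (pot_antitone ord S0 i (by omega)) ?_
  rw [← hpot]
  exact pot_antitone ord S0 i (by omega)

variable {S0} in
lemma cum_le_of_isStable {T : ℕ} (h : IsStable G ord S0 T) (k i : ℕ) {d d' : G.Dart}
    (hd : d.snd = d'.snd) :
    cum G ord S0 (T + k) (T + k + i) d ≤ cum G ord S0 (T + k) (T + k + i) d' + 1 := by
  have hpot := pot_eq_add_sum_excess ord S0 i (T + k)
  rw [pot_succ_eq_of_isStable ord h i k, left_eq_add,
    Finset.sum_eq_zero_iff_of_nonneg fun _ _ => excess_nonneg _ _] at hpot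
  have h1 := excess_eq_zero_iff.mp (hpot d (Finset.mem_univ _))
  have h2 := excess_eq_zero_iff.mp (hpot d' (Finset.mem_univ _))
  rw [hd] at h1
  omega

lemma cum_add (t i j : ℕ) (d : G.Dart) :
    cum G ord S0 t (t + (i + j)) d =
      cum G ord S0 t (t + i) d + cum G ord S0 (t + i) (t + i + j) d := by
  simp only [cum_eq_sum_range, Finset.sum_range_add]
  simp only [Nat.add_assoc]

variable {S0} in
lemma cum_le_of_cum_lt {T : ℕ} (h : IsStable G ord S0 T) {d d' : G.Dart}
    (hd : d.snd = d'.snd) {i : ℕ} (hlt : cum G ord S0 T (T + i) d < cum G ord S0 T (T + i) d')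
    (j : ℕ) : cum G ord S0 T (T + j) d ≤ cum G ord S0 T (T + j) d' := by
  rcases Nat.le_total i j with hij | hij <;> obtain ⟨k, rfl⟩ := Nat.exists_eq_add_of_le hij
  · have := cum_le_of_isStable ord h i k hd
    rw [cum_add, cum_add]
    omega
  · have := cum_le_of_isStable ord h j k hd.symm
    rw [cum_add, cum_add] at hlt
    omega

variable {S0} in
lemma aligned_cum_of_sum_le {T : ℕ} (h : IsStable G ord S0 T) {d d' : G.Dart}
    (hd : d.snd = d'.snd) {N : ℕ}
    (hle : ∑ i ∈ Finset.range N, cum G ord S0 T (T + i) d' ≤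
      ∑ i ∈ Finset.range N, cum G ord S0 T (T + i) d) {i : ℕ} (hi : i < N) :
    Aligned (cum G ord S0 T (T + i) d) (cum G ord S0 T (T + i) d') := by
  refine ⟨?_, cum_le_of_isStable ord h 0 i hd⟩
  by_contra! hlt
  exact hle.not_gt (Finset.sum_lt_sum (fun j _ => cum_le_of_cum_lt ord h hd hlt j)
    ⟨i, Finset.mem_range.mpr hi, hlt⟩)

lemma exists_equiv_fin_monotone {α L : Type*} [LinearOrder L] (s : Finset α) {n : ℕ}
    (hs : s.card = n) (w : α → L) :
    ∃ e : Fin n ≃ s, Monotone fun i => w (e i) :=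
  ⟨(Tuple.sort fun i => w ((s.equivFinOfCardEq hs).symm i)).trans (s.equivFinOfCardEq hs).symm,
    Tuple.monotone_sort fun i => w ((s.equivFinOfCardEq hs).symm i)⟩

/-- Finsets of the same size can be matched so that one weight decreases while the other
increases. -/
lemma exists_equiv_antivary {α β : Type*} {s : Finset α} {s' : Finset β}
    (h : s.card = s'.card) (w : α → ℕ) (r : β → ℕ) :
    ∃ e : s ≃ s', ∀ a b : s, (w b ≤ w a ∧ r (e a) ≤ r (e b)) ∨
      (w a ≤ w b ∧ r (e b) ≤ r (e a)) := by
  obtain ⟨e₁, h₁⟩ := exists_equiv_fin_monotone s h fun a => OrderDual.toDual (w a)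
  obtain ⟨e₂, h₂⟩ := exists_equiv_fin_monotone s' rfl r
  refine ⟨e₁.symm.trans e₂, fun a b => ?_⟩
  obtain ⟨i, rfl⟩ := e₁.surjective a
  obtain ⟨j, rfl⟩ := e₁.surjective b
  simp only [Equiv.trans_apply, Equiv.symm_apply_apply]
  rcases le_total i j with hij | hij
  · exact Or.inl ⟨h₁ hij, h₂ hij⟩
  · exact Or.inr ⟨h₁ hij, h₂ hij⟩

variable {S0} in
lemma hasSubcycleDecomp_of_isStable {T : ℕ} (h : IsStable G ord S0 T) (N : ℕ) :
    HasSubcycleDecomp G ord S0 T N := by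
  choose e he using fun v => exists_equiv_antivary
    ((card_inArcs (G := G) v).trans (card_outArcs v).symm)
    (fun d => ∑ i ∈ Finset.range (N + 1), cum G ord S0 T (T + i) d)
    (rotorRank ord (evol G ord S0 (T + 1)))
  have hout (v : V) (d : inArcs G v) : (e v d : G.Dart).fst = v := mem_outArcs.mp (e v d).2
  have hcum (v : V) {i : ℕ} (hi : i ≤ N) (d : inArcs G v) :
      cum G ord S0 T (T + i) d = cum G ord S0 (T + 1) (T + 1 + i) (e v d) := by
    have hv : 0 < G.degree v := by
      rw [← card_inArcs]; exact Finset.card_pos.mpr ⟨d, d.2⟩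
    refine eqOn_of_aligned (s := Finset.univ)
      (f := fun d : inArcs G v => cum G ord S0 T (T + i) d)
      (g := fun d => cum G ord S0 (T + 1) (T + 1 + i) (e v d)) ?_ ?_ d (Finset.mem_univ d)
    · intro a _ b _
      have hin (a b : inArcs G v) : (a : G.Dart).snd = (b : G.Dart).snd :=
        (mem_inArcs.mp a.2).trans (mem_inArcs.mp b.2).symm
      refine (he v a b).imp ?_ ?_ <;> rintro ⟨hw, hr⟩ <;>
        exact ⟨aligned_cum_of_sum_le ord h (hin _ _) hw (by omega),
          aligned_cum ord S0 _ _ ((hout v _).trans (hout v _).symm) hr⟩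
    · rw [Equiv.sum_comp (e v) fun d => cum G ord S0 (T + 1) (T + 1 + i) (d : G.Dart),
        Finset.sum_coe_sort (inArcs G v) (cum G ord S0 T (T + i)),
        Finset.sum_coe_sort (outArcs G v) (cum G ord S0 (T + 1) (T + 1 + i)),
        sum_inArcs_cum ord S0 _ _ hv, sum_outArcs_cum ord S0 _ _ hv]
  let M (d : G.Dart) : G.Dart := e d.snd ⟨d, mem_inArcs.mpr rfl⟩
  have hM (v : V) (d : inArcs G v) : M d = e v d := by
    obtain ⟨d, hd⟩ := d
    obtain rfl := mem_inArcs.mp hd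
    rfl
  have hfst (d : G.Dart) : (M d).fst = d.snd := hout _ _
  refine ⟨M, Finite.injective_iff_bijective.mp fun d d' hdd => ?_, hfst, fun d t hT ht => ?_⟩
  · have hsnd : d.snd = d'.snd := by rw [← hfst, ← hfst, hdd]
    rw [hM d'.snd ⟨d, mem_inArcs.mpr hsnd⟩, hM d'.snd ⟨d', mem_inArcs.mpr rfl⟩] at hdd
    exact congrArg Subtype.val ((e d'.snd).injective (Subtype.ext hdd))
  · obtain ⟨k, rfl⟩ := Nat.exists_eq_add_of_le hT
    have h1 := hcum d.snd (i := k) (by omega) ⟨d, mem_inArcs.mpr rfl⟩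
    have h2 := hcum d.snd (i := k + 1) (by omega) ⟨d, mem_inArcs.mpr rfl⟩
    rw [cum_succ, cum_succ, h1, Nat.add_left_cancel_iff] at h2
    rw [show T + k + 1 = T + 1 + k by omega]
    exact h2

variable (G)

/-- A rotor-router state `S_T` is stable iff it admits an ∞-subcycle
decomposition (an `i`-step one for every `i ≥ 1`), iff it admits a `(2m²)`-step subcycle
decomposition, where `m` is the number of edges. -/
theorem stable_iff_subcycle_decomposition (hconn : G.Connected) (S0 : State G) (T : ℕ) :
    (IsStable G ord S0 T ↔ ∀ i : ℕ, 1 ≤ i → HasSubcycleDecomp G ord S0 T i) ∧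
    (IsStable G ord S0 T ↔ HasSubcycleDecomp G ord S0 T (2 * G.edgeFinset.card ^ 2)) := by
  refine ⟨⟨fun h i _ => hasSubcycleDecomp_of_isStable ord h i, fun h => ?_⟩,
    fun h => hasSubcycleDecomp_of_isStable ord h _, isStable_of_hasSubcycleDecomp ord S0⟩
  obtain ⟨M, hbij, hfst, hload⟩ := h (2 * G.edgeFinset.card ^ 2 + 1) (by omega)
  exact isStable_of_hasSubcycleDecomp ord S0
    ⟨M, hbij, hfst, fun d t hT ht => hload d t hT (by omega)⟩

end RotorRouter
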